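/- Let (R, m, k) be a d-dimensional Gorenstein Noetherian local ring of prime characteristic p, and x ∈ m a nonzerodivisor. Then the map R → F^e_*R sending 1 ↦ F^e_*(x^{p^e−1}) is pure if and only if the Frobenius R/xR → F^e_*(R/xR) becomes injective after tensoring with H^{d−1}_m(R/xR); equivalently (taking all e ≥ 1), the pair (R, div(x)) is F-pure if and only if R/xR is F-pure. -/

import Mathlib

open TensorProduct IsLocalRing

universe u

/-- `Fstar p e A` is `A` viewed as a module over itself via the `e`-th iterate of the
Frobenius endomorphism: the module `F^e_* A`. -/
def Fstar (p e : ℕ) (A : Type u) : Type u := A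

instance (p e : ℕ) (A : Type u) [CommRing A] : CommRing (Fstar p e A) :=
  inferInstanceAs (CommRing A)

instance (p e : ℕ) (A : Type u) [CommRing A] [Fact p.Prime] [CharP A p] :
    Module A (Fstar p e A) :=
  Module.compHom A (iterateFrobenius A p e)

/-- Purity of the `A`-linear map `A → F^e_* A` sending `1` to (the class of) `a`:
for every `A`-module `P` the induced map `P → P ⊗_A F^e_* A`, `m ↦ m ⊗ a`, is injective. -/
def PureAt (p e : ℕ) (A : Type u) [CommRing A] [Fact p.Prime] [CharP A p] (a : A) : Prop :=
  ∀ (P : Type u) [AddCommGroup P] [Module A P],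
    Function.Injective
      (fun m : P => (m ⊗ₜ[A] (show Fstar p e A from a) : TensorProduct A P (Fstar p e A)))

/-- A ring `A` of prime characteristic `p` is `F`-pure if the Frobenius maps
`A → F^e_* A`, `1 ↦ 1`, are pure for all `e ≥ 1`. -/
def IsFPureRing (p : ℕ) (A : Type u) [CommRing A] [Fact p.Prime] [CharP A p] : Prop :=
  ∀ e : ℕ, 0 < e → PureAt p e A 1

/-- A Noetherian local ring is Gorenstein if it is Cohen–Macaulay (it admits a regular
sequence of length `dim R` in the maximal ideal) and some (equivalently, every) ideal
generated by a system of parameters is irreducible, i.e. the corresponding Artinian quotient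
has simple socle. -/
def IsGorensteinLocalRing (R : Type u) [CommRing R] [IsLocalRing R] : Prop :=
  ∃ rs : List R, (∀ a ∈ rs, a ∈ maximalIdeal R) ∧
    RingTheory.Sequence.IsRegular R rs ∧
    ringKrullDim R = (rs.length : WithBot (WithTop ℕ)) ∧
    IsSimpleModule (R ⧸ Ideal.span {a | a ∈ rs})
      ↥(Submodule.colon (⊥ : Submodule (R ⧸ Ideal.span {a | a ∈ rs})
            (R ⧸ Ideal.span {a | a ∈ rs}))
          ((maximalIdeal R).map (Ideal.Quotient.mk (Ideal.span {a | a ∈ rs}))))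

section ExtCompare
open CategoryTheory Limits Abelian

theorem kerπ {A : Type u} [CommRing A] (M : CochainComplex (ModuleCat.{u} A) ℕ) (n : ℕ)
    (c : M.cycles n) : M.homologyπ n c = 0 ↔
      ∃ b : M.X ((ComplexShape.up ℕ).prev n), M.d _ n b = M.iCycles n c := by
    have ex : (ShortComplex.mk (M.toCycles ((ComplexShape.up ℕ).prev n) n) (M.homologyπ n)
      (by simp)).Exact := ShortComplex.exact_of_g_is_cokernel _ (M.homologyIsCokernel _ n rfl)
    have hinj := (ModuleCat.mono_iff_injective (M.iCycles n)).1 inferInstance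
    rw [ShortComplex.moduleCat_exact_iff] at ex
    constructor
    · intro hc
      obtain ⟨b, hb⟩ := ex c hc
      refine ⟨b, ?_⟩
      rw [← hb]
      exact (ConcreteCategory.congr_hom (M.toCycles_i ((ComplexShape.up ℕ).prev n) n) b).symm
    · rintro ⟨b, hb⟩
      have : c = M.toCycles ((ComplexShape.up ℕ).prev n) n b := by
        apply hinj
        rw [← hb]
        exact (ConcreteCategory.congr_hom (M.toCycles_i ((ComplexShape.up ℕ).prev n) n) b).symm
      rw [this]
      exact ConcreteCategory.congr_hom
        (M.toCycles_comp_homologyπ ((ComplexShape.up ℕ).prev n) n) b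

theorem hom_inj_of_cocycle {A : Type u} [CommRing A] {K L : CochainComplex (ModuleCat.{u} A) ℕ}
    (ψ : K ⟶ L) (n : ℕ)
    (h : ∀ f : K.X n, K.d n (n+1) f = 0 →
      (∃ b : L.X ((ComplexShape.up ℕ).prev n), L.d _ n b = ψ.f n f) →
      ∃ b : K.X ((ComplexShape.up ℕ).prev n), K.d _ n b = f) :
    Function.Injective (HomologicalComplex.homologyMap ψ n) := by
  rw [injective_iff_map_eq_zero]
  intro z hz
  obtain ⟨c, rfl⟩ := (ModuleCat.epi_iff_surjective (K.homologyπ n)).1 inferInstance z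
  have h1 : L.homologyπ n (HomologicalComplex.cyclesMap ψ n c) = 0 := by
    rw [← hz]
    have := HomologicalComplex.homologyπ_naturality ψ n
    exact (ConcreteCategory.congr_hom this c).symm
  rw [kerπ] at h1 ⊢
  apply h
  · exact ConcreteCategory.congr_hom (K.iCycles_d n (n+1)) c
  · obtain ⟨b, hb⟩ := h1
    refine ⟨b, hb.trans ?_⟩
    exact ConcreteCategory.congr_hom (HomologicalComplex.cyclesMap_i ψ n) c

theorem extMk_eq_zero_iff' {A : Type u} [CommRing A] {X Y : ModuleCat.{u} A}
    (P : ProjectiveResolution X) (n : ℕ) (f : P.complex.X n ⟶ Y) 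
    (hf : P.complex.d (n+1) n ≫ f = 0) :
    P.extMk f (n+1) rfl hf = 0 ↔ 
    ∃ b : P.complex.X ((ComplexShape.up ℕ).prev n) ⟶ Y, P.complex.d n _ ≫ b = f := by
  cases n with
  | succ n =>
    rw [P.extMk_eq_zero_iff f _ _ hf n rfl]
    have : (ComplexShape.up ℕ).prev (n+1) = n := by simp
    rw [this]
  | zero =>
    have e : (ComplexShape.up ℕ).prev 0 = 0 := by simp
    rw [e]
    simp only [← P.extEquivCohomologyClass.apply_eq_iff_eq,
      ProjectiveResolution.extEquivCohomologyClass_extMk,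
      ProjectiveResolution.extEquivCohomologyClass_zero,
      CochainComplex.HomComplex.CohomologyClass.mk_eq_zero_iff]
    rw [CochainComplex.HomComplex.Cocycle.toSingleMk_mem_coboundaries_iff _ _ _ _ _ 1 (by lia)]
    have hz : IsZero (P.cochainComplex.X 1) := by
      apply P.cochainComplex.isZero_of_isStrictlyLE 0 1 (by lia)
    have hd : P.complex.d 0 0 = 0 := P.complex.shape _ _ (by simp)
    constructor
    · rintro ⟨g, hg⟩
      have : g = 0 := hz.eq_of_src _ _
      subst this
      refine ⟨0, ?_⟩
      rw [← cancel_epi (P.cochainComplexXIso (-(0:ℕ)) 0 rfl).hom]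
      simp at hg ⊢
      exact hg
    · rintro ⟨g, hg⟩
      rw [hd] at hg
      refine ⟨0, ?_⟩
      simp at hg
      rw [← hg]; simp

end ExtCompare

section ExtCompare2
open CategoryTheory Limits Abelian

theorem epi_of_iso_comp {C : Type*} [Category C] {a b c : C} (f : a ⟶ b) (i : b ≅ c)
    (h : Epi (f ≫ i.hom)) : Epi f := by
  have h4 := epi_comp (f ≫ i.hom) i.inv
  rwa [Category.assoc, Iso.hom_inv_id, Category.comp_id] at h4

/-- chain map gives map of Hom complexes -/
noncomputable def yonMap {A : Type u} [CommRing A] {K L : ChainComplex (ModuleCat.{u} A) ℕ}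
    (φ : K ⟶ L) (Y : ModuleCat.{u} A) : L.linearYonedaObj A Y ⟶ K.linearYonedaObj A Y :=
  (HomologicalComplex.unopFunctor _ _).map
    ((((linearYoneda A (ModuleCat.{u} A)).obj Y).rightOp.mapHomologicalComplex _).map φ).op

theorem oldExt_map_inj {A : Type u} [CommRing A] {X X' Y : ModuleCat.{u} A} (g : X' ⟶ X) (n : ℕ)
    (h : Function.Injective (fun e : Abelian.Ext.{u} X Y n =>
        (Ext.mk₀ g).comp e (zero_add n))) :
    Function.Injective (((_root_.Ext A (ModuleCat.{u} A) n).map g.op).app Y) := by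
  let P := projectiveResolution X
  let P' := projectiveResolution X'
  let φ : ProjectiveResolution.Hom P' P g :=
    ⟨ProjectiveResolution.lift g P' P, by
      simpa using ProjectiveResolution.lift_commutes_zero g P' P⟩
  have key : Function.Injective (HomologicalComplex.homologyMap (yonMap φ.hom Y) n) := by
    apply hom_inj_of_cocycle
    intro f hf hb
    change P.complex.X n ⟶ Y at f
    change P.complex.d (n+1) n ≫ f = 0 at hf
    change ∃ b : P'.complex.X ((ComplexShape.up ℕ).prev n) ⟶ Y, P'.complex.d n _ ≫ b = φ.hom.f n ≫ f at hb
    change ∃ b : P.complex.X ((ComplexShape.up ℕ).prev n) ⟶ Y, P.complex.d n _ ≫ b = f 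
    have := ProjectiveResolution.mk₀_comp_extMk f (n+1) rfl hf φ
    rw [← extMk_eq_zero_iff' P n f hf]
    rw [← extMk_eq_zero_iff' P' n _ (by simp [← φ.hom.comm_assoc, hf])] at hb
    apply h
    simp only [this, hb, Ext.comp_zero]
  let F := ((linearYoneda A (ModuleCat.{u} A)).obj Y).rightOp
  have nat := ProjectiveResolution.isoLeftDerivedObj_hom_naturality g P' P φ.hom
    (ProjectiveResolution.lift_commutes_zero g P' P) F n
  have : Epi ((F.mapHomologicalComplex _ ⋙ HomologicalComplex.homologyFunctor _ _ n).map φ.hom) := by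
    have hm : Mono (HomologicalComplex.homologyMap (yonMap φ.hom Y) n) :=
      (ModuleCat.mono_iff_injective _).2 key
    have e := HomologicalComplex.homologyOp_hom_naturality (yonMap φ.hom Y) n
    have h2 : Epi (HomologicalComplex.homologyMap
        ((F.mapHomologicalComplex (ComplexShape.down ℕ)).map φ.hom) n ≫
        ((P.complex.linearYonedaObj A Y).homologyOp n).hom) := by
      have h3 : Epi (((P'.complex.linearYonedaObj A Y).homologyOp n).hom ≫
        (HomologicalComplex.homologyMap (yonMap φ.hom Y) n).op) := inferInstance
      exact e ▸ h3
    exact epi_of_iso_comp _ ((P.complex.linearYonedaObj A Y).homologyOp n) h2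
  have h5 : Epi ((F.leftDerived n).map g) := by
    have h6 : Epi ((F.leftDerived n).map g ≫ (P.isoLeftDerivedObj F n).hom) := by
      rw [nat]; infer_instance
    exact epi_of_iso_comp _ _ h6
  have h7 : Mono ((F.leftDerived n).map g).unop := inferInstance
  exact (ModuleCat.mono_iff_injective _).1 h7

theorem extMk_smul {A : Type u} [CommRing A] {X Y : ModuleCat.{u} A}
    (P : ProjectiveResolution X) (n : ℕ) (f : P.complex.X n ⟶ Y)
    (hf : P.complex.d (n+1) n ≫ f = 0) (r : A) :
    r • P.extMk f (n+1) rfl hf = P.extMk (r • f) (n+1) rfl (by simp [hf]) := by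
  rw [Ext.smul_eq_comp_mk₀, P.extMk_comp_mk₀]
  simp

theorem newExt_equiv_old {A : Type u} [CommRing A] (X Y : ModuleCat.{u} A) (n : ℕ) :
    Nonempty (Abelian.Ext.{u} X Y n ≃ₗ[A]
      (((_root_.Ext A (ModuleCat.{u} A) n).obj (Opposite.op X)).obj Y)) := by
  let P := projectiveResolution X
  let K := P.complex.linearYonedaObj A Y
  let i : K.cycles n →ₗ[A] (P.complex.X n ⟶ Y) := (K.iCycles n).hom
  have hi : ∀ c, P.complex.d (n+1) n ≫ i c = 0 := fun c =>
    ConcreteCategory.congr_hom (K.iCycles_d n (n+1)) c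
  let E : K.cycles n →ₗ[A] Abelian.Ext.{u} X Y n :=
    { toFun := fun c => P.extMk (i c) (n+1) rfl (hi c)
      map_add' := fun a b => by
        rw [P.add_extMk]; congr 1; exact map_add i a b
      map_smul' := fun r a => by
        rw [RingHom.id_apply, extMk_smul]; congr 1; exact map_smul i r a }
  have hE : Function.Surjective E := by
    intro α
    obtain ⟨f, hf, rfl⟩ := P.extMk_surjective α (n+1) rfl
    have ex : (ShortComplex.mk (K.iCycles n) (K.d n (n+1)) (by simp)).Exact :=
      ShortComplex.exact_of_f_is_kernel _ (K.cyclesIsKernel n (n+1) (by simp))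
    rw [ShortComplex.moduleCat_exact_iff] at ex
    obtain ⟨c, hc⟩ := ex f hf
    refine ⟨c, ?_⟩
    have hc' : i c = f := hc
    change P.extMk (i c) (n+1) rfl (hi c) = _
    congr 1
  have hπ : Function.Surjective (K.homologyπ n).hom :=
    (ModuleCat.epi_iff_surjective (K.homologyπ n)).1 inferInstance
  have hk : LinearMap.ker E = LinearMap.ker (K.homologyπ n).hom := by
    ext c
    rw [LinearMap.mem_ker, LinearMap.mem_ker]
    refine (extMk_eq_zero_iff' P n (i c) (hi c)).trans ?_
    exact (kerπ K n c).symm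
  exact ⟨(E.quotKerEquivOfSurjective hE).symm.trans
    ((Submodule.quotEquivOfEq _ _ hk).trans
      (((K.homologyπ n).hom.quotKerEquivOfSurjective hπ).trans
        (P.isoExt n Y).symm.toLinearEquiv))⟩

end ExtCompare2

section LC
open CategoryTheory Limits Abelian

theorem lc_inj {A : Type u} [CommRing A] (J : Ideal A) (i : ℕ) (Y : ModuleCat.{u} A)
    (h : ∀ (a b : ℕ) (hab : a ≤ b), Function.Injective
      (fun e : Abelian.Ext.{u} (ModuleCat.of A (A ⧸ J ^ a)) Y i =>
        (Ext.mk₀ (ModuleCat.ofHom (Submodule.mapQ (J ^ b) (J ^ a) LinearMap.id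
          (Ideal.pow_le_pow_right hab)))).comp e (zero_add i))) (n : ℕ) :
    ∃ f : Abelian.Ext.{u} (ModuleCat.of A (A ⧸ J ^ n)) Y i →ₗ[A] ((localCohomology J i).obj Y),
      Function.Injective f := by
  obtain ⟨e⟩ := newExt_equiv_old (ModuleCat.of A (A ⧸ J ^ n)) Y i
  let D := localCohomology.diagram (localCohomology.idealPowersDiagram J) i
  have := localCohomology.hasColimitDiagram.{u, 0} (localCohomology.idealPowersDiagram J) i
  let c : Cocone D := colimit.cocone D
  have hc : IsColimit c := colimit.isColimit D
  let c' := ((evaluation _ _).obj Y).mapCocone c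
  have hc' : IsColimit c' := isColimitOfPreserves ((evaluation _ _).obj Y) hc
  have hm : ∀ {a b : (ℕᵒᵖ)ᵒᵖ} (w : a ⟶ b), Mono ((D ⋙ (evaluation _ _).obj Y).map w) := by
    intro a b w
    rw [ModuleCat.mono_iff_injective]
    refine oldExt_map_inj (ModuleCat.ofHom (Submodule.mapQ (J ^ b.unop.unop) (J ^ a.unop.unop)
      LinearMap.id (Ideal.pow_le_pow_right w.unop.unop.down.down))) i ?_
    exact h a.unop.unop b.unop.unop w.unop.unop.down.down
  have hmono : Function.Injective (c'.ι.app (Opposite.op (Opposite.op n))) := by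
    have : PreservesFilteredColimitsOfSize.{0, 0} (forget (ModuleCat.{u} A)) :=
      preservesFilteredColimitsOfSize_shrink _
    intro x y hxy
    obtain ⟨k, f, g, hfg⟩ := Concrete.isColimit_exists_of_rep_eq _ hc' x y hxy
    have : f = g := Subsingleton.elim _ _
    subst this
    exact (ModuleCat.mono_iff_injective _).1 (hm f) hfg
  refine ⟨(c'.ι.app (Opposite.op (Opposite.op n))).hom ∘ₗ e.toLinearMap, ?_⟩
  exact hmono.comp e.injective
end LC

section ExtReg
open CategoryTheory Limits Abelian RingTheory.Sequence
open scoped Pointwise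

theorem smul_ext_zero {A : Type u} [CommRing A] {N Y : ModuleCat.{u} A} (r : A)
    (hr : ∀ z : N, r • z = 0) {i : ℕ} (e : Ext.{u} N Y i) : r • e = 0 := by
  have h1 : r • e = (r • Ext.mk₀ (𝟙 N)).comp e (zero_add i) := by
    rw [Ext.smul_comp, Ext.mk₀_id_comp]
  have h2 : r • (𝟙 N) = 0 := by
    ext z; exact hr z
  rw [h1, ← Ext.mk₀_smul, h2, Ext.mk₀_zero, Ext.zero_comp]

theorem ext_reg_step {A : Type u} [CommRing A] (r : A) (M : ModuleCat.{u} A)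
    (hreg : IsSMulRegular M r) :
    ∃ δ : Ext.{u} (ModuleCat.of A (QuotSMulTop r M)) M 1,
      (∀ (N : ModuleCat.{u} A), (∀ z : N, r • z = 0) → ∀ (i : ℕ) (e : Ext.{u} N M (i+1)),
        ∃ e' : Ext.{u} N (ModuleCat.of A (QuotSMulTop r M)) i, e'.comp δ rfl = e) ∧
      (∀ (N : ModuleCat.{u} A) (i : ℕ) (e : Ext.{u} N (ModuleCat.of A (QuotSMulTop r M)) i),
        e.comp δ rfl = 0 → ∃ (g : M ⟶ ModuleCat.of A (QuotSMulTop r M)) (e' : Ext.{u} N M i),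
          e'.comp (Ext.mk₀ g) (add_zero _) = e) := by
  refine ⟨(hreg.smulShortComplex_shortExact).extClass, fun N hr i e => ?_, fun N i e he => ?_⟩
  · apply Ext.covariant_sequence_exact₁ N (hreg.smulShortComplex_shortExact) e
    exact (Ext.smul_eq_comp_mk₀ e r).symm.trans (smul_ext_zero r hr e)
  · obtain ⟨y, hy⟩ := Ext.covariant_sequence_exact₃ N (hreg.smulShortComplex_shortExact) e rfl he
    exact ⟨_, y, hy⟩

theorem ext_reg {A : Type u} [CommRing A] (rs : List A) :
    ∀ (M : Type u) [AddCommGroup M] [Module A M], IsWeaklyRegular M rs →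
    (∀ (N : ModuleCat.{u} A), (∀ r ∈ rs, ∀ z : N, r • z = 0) → ∀ i < rs.length,
        ∀ e : Ext.{u} N (ModuleCat.of A M) i, e = 0) ∧
    ∃ η : Ext.{u} (ModuleCat.of A (M ⧸ (Ideal.ofList rs • (⊤ : Submodule A M))))
        (ModuleCat.of A M) rs.length,
      ∀ (N : ModuleCat.{u} A), (∀ r ∈ rs, ∀ z : N, r • z = 0) → Function.Bijective
        (fun f : N ⟶ ModuleCat.of A (M ⧸ (Ideal.ofList rs • (⊤ : Submodule A M))) =>
          (Ext.mk₀ f).comp η (zero_add _)) := by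
  induction rs with
  | nil =>
    intro M _ _ _
    refine ⟨fun N _ i hi => by simp at hi, ?_⟩
    have e0 : Ideal.ofList ([] : List A) • (⊤ : Submodule A M) = ⊥ := by simp
    let E : ModuleCat.of A (M ⧸ (Ideal.ofList ([] : List A) • (⊤ : Submodule A M))) ≅
        ModuleCat.of A M := (Submodule.quotEquivOfEqBot _ e0).toModuleIso
    refine ⟨Ext.mk₀ E.hom, fun N _ => ?_⟩
    have : (fun f : N ⟶ ModuleCat.of A (M ⧸ (Ideal.ofList ([] : List A) • (⊤ : Submodule A M))) =>
          (Ext.mk₀ f).comp (Ext.mk₀ E.hom) (zero_add 0)) =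
        (fun f => Ext.addEquiv₀.symm (f ≫ E.hom)) := by
      funext f
      rw [Ext.mk₀_comp_mk₀]; rfl
    refine this ▸ (Equiv.bijective (E.homToEquiv.trans Ext.addEquiv₀.symm.toEquiv))
  | cons r rs ih =>
    intro M _ _ h
    obtain ⟨hr, hrs⟩ := (isWeaklyRegular_cons_iff M r rs).1 h
    obtain ⟨ih1, η, hη⟩ := ih (QuotSMulTop r M) hrs
    have hr' : IsSMulRegular (ModuleCat.of A M) r := hr
    obtain ⟨δ, hδ1, hδ2⟩ := ext_reg_step r (ModuleCat.of A M) hr'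
    have van : (∀ (N : ModuleCat.{u} A), (∀ a ∈ r :: rs, ∀ z : N, a • z = 0) →
        ∀ i < (r :: rs).length, ∀ e : Ext.{u} N (ModuleCat.of A M) i, e = 0) := by
      intro N hN i hi e
      cases i with
      | zero =>
        obtain ⟨f, rfl⟩ := Ext.addEquiv₀.symm.surjective e
        have : f = 0 := by
          ext z
          apply hr
          change r • f z = r • 0
          rw [← map_smul, hN r (by simp), map_zero, smul_zero]
        rw [this, map_zero]
      | succ i =>
        obtain ⟨e', rfl⟩ := hδ1 N (hN r (by simp)) i e
        rw [ih1 N (fun a ha => hN a (by simp [ha])) i (by simpa using hi) e', Ext.zero_comp]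
    refine ⟨van, ?_⟩
    let E : ModuleCat.of A (M ⧸ (Ideal.ofList (r :: rs) • (⊤ : Submodule A M))) ≅
        ModuleCat.of A (QuotSMulTop r M ⧸ (Ideal.ofList rs • (⊤ : Submodule A (QuotSMulTop r M)))) :=
      (Submodule.quotOfListConsSMulTopEquivQuotSMulTopInner M r rs).toModuleIso
    refine ⟨((Ext.mk₀ E.hom).comp η (zero_add _)).comp
      δ rfl, fun N hN => ?_⟩
    have hb := hη N (fun a ha => hN a (by simp [ha]))
    have hδ : Function.Bijective (fun e : Ext.{u} N (ModuleCat.of A (QuotSMulTop r M)) rs.length =>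
        e.comp δ (rfl : _ = (r :: rs).length)) := by
      constructor
      · intro a b hab
        rw [← sub_eq_zero]
        have h0 : (a - b).comp δ
          (rfl : _ = (r :: rs).length) = 0 := by
          rw [sub_eq_add_neg, Ext.add_comp, Ext.neg_comp, ← sub_eq_add_neg, sub_eq_zero]
          exact hab
        obtain ⟨g, x, hx⟩ := hδ2 N _ (a - b) h0
        rw [← hx, van N hN _ (by simp) x, Ext.zero_comp]
      · intro e
        exact hδ1 N (hN r (by simp)) rs.length e
    have := hδ.comp (hb.comp (Equiv.bijective E.homToEquiv))
    convert this using 1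
    funext f
    simp only [Function.comp, Iso.homToEquiv_apply]
    rw [← Ext.mk₀_comp_mk₀, ← Ext.comp_assoc, ← Ext.comp_assoc]
    all_goals simp
end ExtReg

section Dual
open Module

theorem length_le_mid {R M N P : Type*} [CommRing R] [AddCommGroup M] [AddCommGroup N]
    [AddCommGroup P] [Module R M] [Module R N] [Module R P] (f : N →ₗ[R] M) (g : M →ₗ[R] P)
    (h : Function.Exact f g) : length R M ≤ length R N + length R P := by
  have h1 : length R M = length R (LinearMap.ker g) + length R (LinearMap.range g) :=
    length_eq_add_of_exact (LinearMap.ker g).subtype g.rangeRestrict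
      (Submodule.subtype_injective _) g.surjective_rangeRestrict
      (by intro y; simp [LinearMap.rangeRestrict, Subtype.ext_iff])
  rw [h1]
  gcongr
  · rw [LinearMap.exact_iff.1 h]
    exact length_le_of_surjective f.rangeRestrict f.surjective_rangeRestrict
  · exact length_le_of_injective _ (Submodule.subtype_injective _)

theorem length_hom_le {R : Type u} [CommRing R] {E : Type u} [AddCommGroup E] [Module R E]
    (hS : ∀ (S : Type u) [AddCommGroup S] [Module R S], IsSimpleModule R S →
      length R (S →ₗ[R] E) ≤ 1)
    {N : Type u} [AddCommGroup N] [Module R N] (hN : IsFiniteLength R N) :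
    length R (N →ₗ[R] E) ≤ length R N := by
  induction hN with
  | of_subsingleton =>
    rename_i M _ _ _
    have : Subsingleton (M →ₗ[R] E) := ⟨fun f g => by ext z; simp [Subsingleton.elim z 0]⟩
    simp
  | of_simple_quotient h ih =>
    rename_i M _ _ N hs
    have h1 := length_le_mid _ _ (LinearMap.exact_lcomp_of_exact_of_surjective E
      (LinearMap.exact_subtype_mkQ N) (Submodule.mkQ_surjective N))
    have h2 := length_eq_add_of_exact N.subtype N.mkQ (Submodule.subtype_injective _)
      (Submodule.mkQ_surjective N) (LinearMap.exact_subtype_mkQ N)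
    rw [h2, add_comm]
    refine h1.trans ?_
    gcongr
    rw [length_eq_one_iff.2 hs]
    exact hS _ hs

theorem length_le_hom {R : Type u} [CommRing R] (I : Ideal R)
    (hI : IsFiniteLength R (R ⧸ I))
    (hS : ∀ (S : Type u) [AddCommGroup S] [Module R S], IsSimpleModule R S →
      length R (S →ₗ[R] R ⧸ I) ≤ 1)
    {N : Type u} [AddCommGroup N] [Module R N] [Module.Finite R N]
    (hN : ∀ r ∈ I, ∀ z : N, r • z = 0) :
    IsFiniteLength R N ∧ length R N ≤ length R (N →ₗ[R] R ⧸ I) := by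
  obtain ⟨n, v, hv⟩ := Module.Finite.exists_fin (R := R) (M := N)
  have hFl : IsFiniteLength R (Fin n → R ⧸ I) := by
    rw [isFiniteLength_iff_isNoetherian_isArtinian] at hI ⊢
    obtain ⟨_, _⟩ := hI
    exact ⟨inferInstanceAs (IsNoetherian R (Fin n → R ⧸ I)),
      inferInstanceAs (IsArtinian R (Fin n → R ⧸ I))⟩
  let g : (Fin n → R ⧸ I) →ₗ[R] N := LinearMap.lsum R (fun _ => R ⧸ I) R
    (fun i => Submodule.liftQ I (LinearMap.toSpanSingleton R N (v i))
      (fun r hr => by simp [hN r hr]))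
  have hg : Function.Surjective g := by
    rw [← LinearMap.range_eq_top, eq_top_iff, ← hv, Submodule.span_le]
    rintro _ ⟨i, rfl⟩
    refine ⟨Pi.single i (Submodule.Quotient.mk 1), ?_⟩
    simp only [g, LinearMap.lsum_apply, LinearMap.coe_sum, Finset.sum_apply, LinearMap.comp_apply,
      LinearMap.proj_apply]
    rw [Finset.sum_eq_single i]
    · rw [Pi.single_eq_same]; exact (Submodule.liftQ_apply _ _ _).trans (one_smul R (v i))
    · intro j _ hj; simp [Pi.single_eq_of_ne hj]
    · simp
  have hNl : IsFiniteLength R N := hFl.of_surjective hg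
  refine ⟨hNl, ?_⟩
  let K := LinearMap.ker g
  have hKl : IsFiniteLength R K := hFl.of_injective (Submodule.subtype_injective K)
  have h1 : length R (Fin n → R ⧸ I) = length R K + length R N :=
    length_eq_add_of_exact K.subtype g (Submodule.subtype_injective _) hg
      (LinearMap.exact_subtype_ker_map g)
  have h2 := length_le_mid _ _ (LinearMap.exact_lcomp_of_exact_of_surjective (R ⧸ I)
      (LinearMap.exact_subtype_ker_map g) hg)
  have h3 := length_hom_le hS hKl
  let B : (Fin n → R ⧸ I) →ₗ[R] (Fin n → R ⧸ I) →ₗ[R] R ⧸ I := LinearMap.mk₂ R (fun v w => ∑ i, v i * w i)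
    (by intros; simp [add_mul, Finset.sum_add_distrib])
    (by intros; simp [Finset.smul_sum])
    (by intros; simp [mul_add, Finset.sum_add_distrib])
    (by intros; simp [Finset.smul_sum])
  have hB : Function.Injective B := by
    intro a b hab
    funext i
    have := LinearMap.congr_fun hab (Pi.single i 1)
    simpa [B, Pi.single_apply] using this
  have h4 := length_le_of_injective B hB
  have h5 : length R K + length R N ≤ length R K + length R (N →ₗ[R] R ⧸ I) := by
    rw [← h1, add_comm]
    exact h4.trans (h2.trans (by gcongr))
  exact (ENat.add_le_add_iff_left (length_ne_top_iff.2 hKl)).1 h5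

theorem duality {R : Type u} [CommRing R] (I : Ideal R)
    (hI : IsFiniteLength R (R ⧸ I))
    (hS : ∀ (S : Type u) [AddCommGroup S] [Module R S], IsSimpleModule R S →
      length R (S →ₗ[R] R ⧸ I) ≤ 1)
    {N : Type u} [AddCommGroup N] [Module R N] [Module.Finite R N]
    (hN : ∀ r ∈ I, ∀ z : N, r • z = 0) (z : N) (hz : z ≠ 0) :
    ∃ f : N →ₗ[R] R ⧸ I, f z ≠ 0 := by
  by_contra! hc
  obtain ⟨hNl, h1⟩ := length_le_hom I hI hS hN
  let Z := Submodule.span R {z}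
  have hQl : IsFiniteLength R (N ⧸ Z) := hNl.of_surjective (Submodule.mkQ_surjective Z)
  have h2 := length_hom_le hS hQl
  have h3 : length R (N →ₗ[R] R ⧸ I) ≤ length R (N ⧸ Z →ₗ[R] R ⧸ I) := by
    refine length_le_of_surjective (LinearMap.lcomp R (R ⧸ I) Z.mkQ) ?_
    intro f
    refine ⟨Z.liftQ f (by rw [Submodule.span_singleton_le_iff_mem]; exact hc f), ?_⟩
    ext; simp
  have h4 := length_eq_add_of_exact Z.subtype Z.mkQ (Submodule.subtype_injective _)
      (Submodule.mkQ_surjective Z) (LinearMap.exact_subtype_mkQ Z)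
  have h5 : length R Z ≤ 0 := by
    refine (ENat.add_le_add_iff_left (length_ne_top_iff.2 hQl)).1 ?_
    rw [add_zero, add_comm, ← h4]
    exact h1.trans (h3.trans h2)
  have h6 : Subsingleton Z := length_eq_zero_iff.1 (le_antisymm h5 bot_le)
  have := h6.elim ⟨z, Submodule.mem_span_singleton_self z⟩ 0
  exact hz (by simpa using this)
end Dual

section Soc
open CategoryTheory Abelian RingTheory.Sequence IsLocalRing Module

/-- every two elements of a cyclic-or-zero simple module -/
def OneGen (R E : Type u) [CommRing R] [AddCommGroup E] [Module R E] : Prop :=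
  ∀ a b : E, a ≠ 0 → ∃ r : R, b = r • a

theorem OneGen.length_le {R E : Type u} [CommRing R] [AddCommGroup E] [Module R E]
    (h : OneGen R E) : length R E ≤ 1 := by
  rcases subsingleton_or_nontrivial E with hE | hE
  · simp
  · have : IsSimpleModule R E := by
      rw [isSimpleModule_iff_toSpanSingleton_surjective]
      refine ⟨hE, fun m hm b => ?_⟩
      obtain ⟨r, hr⟩ := h m b hm
      exact ⟨r, by simp [hr]⟩
    exact (length_eq_one_iff.2 this).le

theorem OneGen.of_bij {R E F : Type u} [CommRing R] [AddCommGroup E] [Module R E]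
    [AddCommGroup F] [Module R F] (h : OneGen R E) (φ : E →ₗ[R] F) (hφ : Function.Bijective φ) :
    OneGen R F := by
  intro a b ha
  obtain ⟨a, rfl⟩ := hφ.2 a
  obtain ⟨b, rfl⟩ := hφ.2 b
  obtain ⟨r, hr⟩ := h a b (fun h => ha (by simp [h]))
  exact ⟨r, by rw [hr, map_smul]⟩

/-- The comparison map as a linear map. -/
noncomputable def extCmp {A : Type u} [CommRing A] {N X Y : ModuleCat.{u} A} {n : ℕ}
    (η : Ext.{u} X Y n) : (N →ₗ[A] X) →ₗ[A] Ext.{u} N Y n where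
  toFun f := (Ext.mk₀ (ModuleCat.ofHom f)).comp η (zero_add _)
  map_add' f g := by
    rw [ModuleCat.ofHom_add, Ext.mk₀_add, Ext.add_comp]
  map_smul' r f := by
    have : ModuleCat.ofHom (r • f) = r • ModuleCat.ofHom f := rfl
    rw [this, Ext.mk₀_smul, Ext.smul_comp]; rfl

theorem ext_reg_ring {A : Type u} [CommRing A] (rs : List A) (h : IsWeaklyRegular A rs) :
    (∀ (N : ModuleCat.{u} A), (∀ r ∈ rs, ∀ z : N, r • z = 0) → ∀ i < rs.length,
        ∀ e : Ext.{u} N (ModuleCat.of A A) i, e = 0) ∧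
    ∃ η : Ext.{u} (ModuleCat.of A (A ⧸ Ideal.ofList rs))
        (ModuleCat.of A A) rs.length,
      ∀ (N : ModuleCat.{u} A), (∀ r ∈ rs, ∀ z : N, r • z = 0) → Function.Bijective
        (extCmp (N := N) η) := by
  obtain ⟨h1, η, h2⟩ := ext_reg rs A h
  refine ⟨h1, ?_⟩
  have key : ∀ I : Ideal A, Ideal.ofList rs • (⊤ : Submodule A A) = I →
      ∃ η : Ext.{u} (ModuleCat.of A (A ⧸ I)) (ModuleCat.of A A) rs.length,
      ∀ (N : ModuleCat.{u} A), (∀ r ∈ rs, ∀ z : N, r • z = 0) → Function.Bijective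
        (extCmp (N := N) η) := by
    rintro _ rfl
    refine ⟨η, fun N hN => ?_⟩
    exact (h2 N hN).comp (ModuleCat.homEquiv.symm.bijective)
  exact key _ (by simp)

theorem simple_hom_length {R : Type u} [CommRing R] [IsLocalRing R] {E : Type u} [AddCommGroup E]
    [Module R E] (h : OneGen R ((R ⧸ maximalIdeal R) →ₗ[R] E))
    (S : Type u) [AddCommGroup S] [Module R S] (hS : IsSimpleModule R S) :
      length R (S →ₗ[R] E) ≤ 1 := by
  obtain ⟨I, hI, ⟨e⟩⟩ := isSimpleModule_iff_quot_maximal.1 hS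
  obtain rfl := eq_maximalIdeal hI
  refine le_trans ?_ h.length_le
  exact length_le_of_injective (LinearMap.lcomp R E e.symm.toLinearMap)
    (LinearMap.lcomp_injective_of_surjective _ e.symm.surjective)

theorem gor_oneGen {R : Type u} [CommRing R] [IsLocalRing R] (I : Ideal R)
    (h : IsSimpleModule (R ⧸ I)
      ↥(Submodule.colon (⊥ : Submodule (R ⧸ I) (R ⧸ I))
          ((maximalIdeal R).map (Ideal.Quotient.mk I)))) :
    OneGen R ((R ⧸ maximalIdeal R) →ₗ[R] R ⧸ I) := by
  have hmem : ∀ a : (R ⧸ maximalIdeal R) →ₗ[R] R ⧸ I, a 1 ∈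
      Submodule.colon (⊥ : Submodule (R ⧸ I) (R ⧸ I))
          ((maximalIdeal R).map (Ideal.Quotient.mk I)) := by
    intro a
    rw [Submodule.mem_colon]
    intro y hy
    obtain ⟨r, hr, rfl⟩ := (Ideal.mem_map_iff_of_surjective _ Ideal.Quotient.mk_surjective).1 hy
    have h0 : (r • (1 : R ⧸ maximalIdeal R)) = 0 := by
      rw [Algebra.smul_def, mul_one]
      exact Ideal.Quotient.eq_zero_iff_mem.2 hr
    have : r • a 1 = 0 := by rw [← map_smul, h0, map_zero]
    rw [Algebra.smul_def] at this
    rw [Submodule.mem_bot, smul_eq_mul, mul_comm]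
    exact this
  intro a b ha
  have ha1 : a 1 ≠ 0 := by
    intro h1
    apply ha
    ext
    simpa using h1
  obtain ⟨-, hsur⟩ := isSimpleModule_iff_toSpanSingleton_surjective.1 h
  obtain ⟨s, hs⟩ := hsur ⟨a 1, hmem a⟩ (fun h => ha1 (by simpa using congrArg Subtype.val h)) ⟨b 1, hmem b⟩
  obtain ⟨r, rfl⟩ := Ideal.Quotient.mk_surjective s
  refine ⟨r, ?_⟩
  have hs' := congrArg Subtype.val hs
  ext
  simp only [LinearMap.toSpanSingleton_apply, Submodule.coe_smul] at hs'
  simp only [LinearMap.coe_comp, Function.comp, LinearMap.smul_apply]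
  exact hs'.symm

/-- Elementwise form of having socle of length at most one. -/
def SocOne (R : Type u) [CommRing R] [IsLocalRing R] (I : Ideal R) : Prop :=
  ∀ a b : R, a ∉ I → (∀ t ∈ maximalIdeal R, t * a ∈ I) → (∀ t ∈ maximalIdeal R, t * b ∈ I) →
    ∃ r, b - r * a ∈ I

theorem socOne_iff {R : Type u} [CommRing R] [IsLocalRing R] (I : Ideal R) :
    SocOne R I ↔ OneGen R ((R ⧸ maximalIdeal R) →ₗ[R] R ⧸ I) := by
  constructor
  · intro h a b ha
    obtain ⟨u, hu⟩ := Ideal.Quotient.mk_surjective (a 1)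
    obtain ⟨v, hv⟩ := Ideal.Quotient.mk_surjective (b 1)
    have hk : ∀ (a : (R ⧸ maximalIdeal R) →ₗ[R] R ⧸ I) (u : R),
        Ideal.Quotient.mk I u = a 1 → ∀ t ∈ maximalIdeal R, t * u ∈ I := by
      intro a u hu t ht
      have h0 : (t • (1 : R ⧸ maximalIdeal R)) = 0 := by
        rw [Algebra.smul_def, mul_one]
        exact Ideal.Quotient.eq_zero_iff_mem.2 ht
      have h1 : t • a 1 = 0 := by rw [← map_smul, h0, map_zero]
      rw [← hu] at h1
      exact Ideal.Quotient.eq_zero_iff_mem.1 h1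
    obtain ⟨r, hr⟩ := h u v (fun hI => ha (by
      ext
      have : a 1 = 0 := by rw [← hu]; exact Ideal.Quotient.eq_zero_iff_mem.2 hI
      simpa using this)) (hk a u hu) (hk b v hv)
    refine ⟨r, ?_⟩
    ext
    have h2 : b 1 = r • a 1 := by
      rw [← hu, ← hv]
      exact Ideal.Quotient.eq.2 hr
    simpa using h2
  · intro h a b ha hka hkb
    have hl : ∀ a : R, (∀ t ∈ maximalIdeal R, t * a ∈ I) →
        ∃ f : (R ⧸ maximalIdeal R) →ₗ[R] R ⧸ I, f 1 = Ideal.Quotient.mk I a := by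
      intro a hka
      refine ⟨Submodule.liftQ (maximalIdeal R) (LinearMap.toSpanSingleton R (R ⧸ I)
        (Ideal.Quotient.mk I a)) (fun t ht => ?_), ?_⟩
      · rw [LinearMap.mem_ker]
        exact Ideal.Quotient.eq_zero_iff_mem.2 (hka t ht)
      · exact (Submodule.liftQ_apply _ _ _).trans (one_smul R _)
    obtain ⟨f, hf⟩ := hl a hka
    obtain ⟨g, hg⟩ := hl b hkb
    obtain ⟨r, hr⟩ := h f g (fun h0 => ha (by
      rw [h0] at hf
      exact Ideal.Quotient.eq_zero_iff_mem.1 hf.symm))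
    refine ⟨r, ?_⟩
    have := LinearMap.congr_fun hr 1
    rw [hg, LinearMap.smul_apply, hf] at this
    exact Ideal.Quotient.eq.1 this

/-- Intrinsic consequences of the Gorenstein property. -/
def GorLike (R : Type u) [CommRing R] [IsLocalRing R] (n : ℕ) : Prop :=
  (∀ ss : List R, (∀ a ∈ ss, a ∈ maximalIdeal R) → IsWeaklyRegular R ss → ss.length = n →
    SocOne R (Ideal.ofList ss)) ∧
  (∀ ss : List R, (∀ a ∈ ss, a ∈ maximalIdeal R) → IsWeaklyRegular R ss → ss.length < n →
    ∃ y ∈ maximalIdeal R, IsSMulRegular (R ⧸ Ideal.ofList ss) y)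

theorem killed_aux {R : Type u} [CommRing R] [IsLocalRing R] (ss : List R)
    (h : ∀ a ∈ ss, a ∈ maximalIdeal R) : ∀ r ∈ ss, ∀ z : ModuleCat.of R (R ⧸ maximalIdeal R),
      r • z = 0 := by
  intro r hr z
  obtain ⟨z, rfl⟩ := Ideal.Quotient.mk_surjective z
  change Ideal.Quotient.mk (maximalIdeal R) (r * z) = 0
  exact Ideal.Quotient.eq_zero_iff_mem.2 (Ideal.mul_mem_right _ _ (h r hr))

theorem gorLike_of {R : Type u} [CommRing R] [IsNoetherianRing R] [IsLocalRing R] (rs : List R)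
    (hrs : ∀ a ∈ rs, a ∈ maximalIdeal R) (hr : IsWeaklyRegular R rs)
    (hs : SocOne R (Ideal.ofList rs)) :
    GorLike R rs.length := by
  obtain ⟨van, η, hη⟩ := ext_reg_ring rs hr
  have h1 : OneGen R (Ext.{u} (ModuleCat.of R (R ⧸ maximalIdeal R)) (ModuleCat.of R R) rs.length) :=
    OneGen.of_bij ((socOne_iff _).1 hs) _ (hη (ModuleCat.of R (R ⧸ maximalIdeal R)) (killed_aux rs hrs))
  have h2 := van (ModuleCat.of R (R ⧸ maximalIdeal R)) (killed_aux rs hrs)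
  generalize rs.length = n at h1 h2
  refine ⟨fun ss hss hw hl => ?_, fun ss hss hw hl => ?_⟩
  · subst hl
    obtain ⟨-, ζ, hζ⟩ := ext_reg_ring ss hw
    rw [socOne_iff]
    let e := LinearEquiv.ofBijective _ (hζ (ModuleCat.of R (R ⧸ maximalIdeal R))
      (killed_aux ss hss))
    exact OneGen.of_bij h1 e.symm.toLinearMap e.symm.bijective
  · obtain ⟨-, ζ, hζ⟩ := ext_reg_ring ss hw
    have hb := hζ (ModuleCat.of R (R ⧸ maximalIdeal R)) (killed_aux ss hss)
    have hsub : Subsingleton ((R ⧸ maximalIdeal R) →ₗ[R] R ⧸ Ideal.ofList ss) :=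
      ⟨fun a b => hb.1 ((h2 _ hl _).trans (h2 _ hl _).symm)⟩
    obtain ⟨y, hy, hy2⟩ := IsSMulRegular.subsingleton_linearMap_iff.1 hsub
    exact ⟨y, by rwa [Ideal.annihilator_quotient] at hy, hy2⟩

theorem gorLike {R : Type u} [CommRing R] [IsNoetherianRing R] [IsLocalRing R]
    (h : IsGorensteinLocalRing R) (d : ℕ) (hd : ringKrullDim R = d) : GorLike R d := by
  obtain ⟨rs, h1, h2, h3, h4⟩ := h
  have : rs.length = d := by
    rw [h3] at hd
    have hd' : ((rs.length : ℕ∞) : WithBot ℕ∞) = ((d : ℕ∞) : WithBot ℕ∞) := hd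
    exact_mod_cast hd'
  subst this
  exact gorLike_of rs h1 h2.1 ((socOne_iff _).2 <| gor_oneGen (Ideal.ofList rs) h4)
end Soc

section Reg
open RingTheory.Sequence IsLocalRing Module

theorem wr_snoc {R : Type u} [CommRing R] (l : List R) (y : R) :
    IsWeaklyRegular R (l ++ [y]) ↔
      IsWeaklyRegular R l ∧ IsSMulRegular (R ⧸ Ideal.ofList l) y := by
  rw [isWeaklyRegular_append_iff, isWeaklyRegular_singleton_iff]
  have e : Ideal.ofList l • (⊤ : Submodule R R) = Ideal.ofList l := by simp
  rw [(Submodule.quotEquivOfEq _ _ e).isSMulRegular_congr y]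

theorem wr_pow {R : Type u} [CommRing R] [IsNoetherianRing R] [IsLocalRing R] (n : ℕ) (hn : 0 < n)
    (l : List R) : ∀ (pre : List R), (∀ a ∈ pre ++ l, a ∈ maximalIdeal R) →
    IsWeaklyRegular R (pre ++ l) → IsWeaklyRegular R (pre ++ l.map (· ^ n)) := by
  induction l with
  | nil => intro pre _ h; simpa using h
  | cons r l ih =>
    intro pre hm h
    have h1 : IsWeaklyRegular R ((pre ++ l) ++ [r]) :=
      isWeaklyRegular_of_perm_of_subset_maximalIdeal h
        (by rw [List.append_assoc]; exact List.Perm.append_left _ (List.perm_append_singleton r l).symm) hm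
    rw [wr_snoc] at h1
    have h2 : IsWeaklyRegular R ((pre ++ l) ++ [r ^ n]) := (wr_snoc _ _).2 ⟨h1.1, h1.2.pow n⟩
    have hr : r ∈ maximalIdeal R := hm r (by simp)
    have hrn : r ^ n ∈ maximalIdeal R := Ideal.pow_mem_of_mem _ hr n hn
    have hm2 : ∀ a ∈ (pre ++ l) ++ [r ^ n], a ∈ maximalIdeal R := by
      intro a ha
      simp only [List.mem_append, List.mem_singleton] at ha
      rcases ha with (ha | ha) | rfl
      · exact hm a (by simp [ha])
      · exact hm a (by simp [ha])
      · exact hrn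
    have hp : List.Perm ((pre ++ l) ++ [r ^ n]) ((pre ++ [r ^ n]) ++ l) := by
      rw [List.append_assoc, List.append_assoc]
      exact List.Perm.append_left _ List.perm_append_comm
    have h3 := isWeaklyRegular_of_perm_of_subset_maximalIdeal h2 hp hm2
    have h4 := ih (pre ++ [r ^ n]) (fun a ha => hm2 a (hp.mem_iff.2 ha)) h3
    simpa using h4

theorem exists_ext_reg {R : Type u} [CommRing R] [IsLocalRing R] {d : ℕ} (h : GorLike R d)
    (ss : List R) (hm : ∀ a ∈ ss, a ∈ maximalIdeal R) (hw : IsWeaklyRegular R ss) :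
    ∀ j, ss.length + j ≤ d → ∃ t : List R, t.length = j ∧ (∀ a ∈ ss ++ t, a ∈ maximalIdeal R) ∧
      IsWeaklyRegular R (ss ++ t) := by
  intro j
  induction j with
  | zero => intro _; exact ⟨[], rfl, by simpa using hm, by simpa using hw⟩
  | succ j ih =>
    intro hj
    obtain ⟨t, h1, h2, h3⟩ := ih (by omega)
    obtain ⟨y, hy, hy2⟩ := h.2 (ss ++ t) h2 h3 (by simp; omega)
    refine ⟨t ++ [y], by simp [h1], ?_, ?_⟩
    · intro a ha
      rw [← List.append_assoc, List.mem_append, List.mem_singleton] at ha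
      rcases ha with ha | rfl
      · exact h2 a ha
      · exact hy
    · rw [← List.append_assoc, wr_snoc]; exact ⟨h3, hy2⟩

theorem fl_of_reg {R : Type u} [CommRing R] [IsNoetherianRing R] [IsLocalRing R] {d : ℕ}
    (hd : ringKrullDim R = d) (ss : List R) (hm : ∀ a ∈ ss, a ∈ maximalIdeal R)
    (hw : IsWeaklyRegular R ss) (hl : ss.length = d) :
    IsFiniteLength R (R ⧸ Ideal.ofList ss) := by
  have h1 := ringKrullDim_add_length_eq_ringKrullDim_of_isRegular ss
    (IsRegular.of_isWeaklyRegular_of_mem_maximalIdeal R hm hw)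
  rw [hd, hl] at h1
  have h0 : ringKrullDim (R ⧸ Ideal.ofList ss) ≤ 0 := by
    generalize ringKrullDim (R ⧸ Ideal.ofList ss) = a at h1
    induction a with
    | bot => simp
    | coe a =>
      have h2 : ((a + (d : ℕ∞) : ℕ∞) : WithBot ℕ∞) = ((0 + (d : ℕ∞) : ℕ∞) : WithBot ℕ∞) := by
        simpa using h1
      have h3 : a + (d : ℕ∞) = 0 + d := by exact_mod_cast h2
      have h4 : a = 0 := by
        exact le_antisymm ((ENat.add_le_add_iff_right (ENat.coe_ne_top d)).1 h3.le) bot_le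
      simp [h4]
  have h5 : Ring.KrullDimLE 0 (R ⧸ Ideal.ofList ss) := by
    rw [Ring.krullDimLE_iff]; exact_mod_cast h0
  have h6 : IsArtinianRing (R ⧸ Ideal.ofList ss) :=
    isArtinianRing_iff_isNoetherianRing_krullDimLE_zero.2 ⟨inferInstance, h5⟩
  rw [isFiniteLength_iff_isNoetherian_isArtinian]
  exact ⟨inferInstance, isArtinian_of_surjective_algebraMap (S := R) (R := R ⧸ Ideal.ofList ss) Ideal.Quotient.mk_surjective⟩

theorem reg_dual {R : Type u} [CommRing R] [IsNoetherianRing R] [IsLocalRing R] {d : ℕ}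
    (hd : ringKrullDim R = d) (hG : GorLike R d)
    (ss : List R) (hm : ∀ a ∈ ss, a ∈ maximalIdeal R)
    (hw : IsWeaklyRegular R ss) (hl : ss.length = d)
    {N : Type u} [AddCommGroup N] [Module R N] [Module.Finite R N]
    (hN : ∀ r ∈ Ideal.ofList ss, ∀ z : N, r • z = 0) (z : N) (hz : z ≠ 0) :
    ∃ f : N →ₗ[R] R ⧸ Ideal.ofList ss, f z ≠ 0 :=
  duality _ (fl_of_reg hd ss hm hw hl)
    (fun S _ _ hS => simple_hom_length ((socOne_iff _).1 (hG.1 ss hm hw hl)) S hS) hN z hz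

theorem ofList_map_pow_le {R : Type u} [CommRing R] [IsLocalRing R] (ss : List R)
    (hm : ∀ a ∈ ss, a ∈ maximalIdeal R) (n : ℕ) :
    ∀ a ∈ ss.map (· ^ n), a ∈ maximalIdeal R ^ n := by
  intro a ha
  obtain ⟨b, hb, rfl⟩ := List.mem_map.1 ha
  exact Ideal.pow_mem_pow (hm b hb) n

/-- regular sequences of length `d` deep inside the maximal ideal -/
theorem exists_deep {R : Type u} [CommRing R] [IsNoetherianRing R] [IsLocalRing R] {d : ℕ}
    (hG : GorLike R d) (n : ℕ) : ∃ ss : List R, ss.length = d ∧ (∀ a ∈ ss, a ∈ maximalIdeal R) ∧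
      (∀ a ∈ ss, a ∈ maximalIdeal R ^ n) ∧ IsWeaklyRegular R ss := by
  obtain ⟨t, h1, h2, h3⟩ := exists_ext_reg hG [] (by simp) (IsWeaklyRegular.nil R R) d (by simp)
  simp only [List.nil_append] at h2 h3
  have h4 := ofList_map_pow_le t h2 (n + 1)
  refine ⟨t.map (· ^ (n+1)), by simp [h1], fun a ha => Ideal.pow_le_self (by simp) (h4 a ha),
    fun a ha => Ideal.pow_le_pow_right (Nat.le_succ n) (h4 a ha), ?_⟩
  exact wr_pow (n+1) (by simp) t [] (by simpa using h2) (by simpa using h3)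

theorem exists_deep_x {R : Type u} [CommRing R] [IsNoetherianRing R] [IsLocalRing R] {d : ℕ}
    (hG : GorLike R (d + 1)) (x : R) (hx : x ∈ maximalIdeal R) (hreg : x ∈ nonZeroDivisors R)
    (n : ℕ) : ∃ y : List R, y.length = d ∧ (∀ a ∈ y, a ∈ maximalIdeal R) ∧
      (∀ a ∈ y, a ∈ maximalIdeal R ^ n) ∧
      (∀ s t : ℕ, 0 < s → 0 < t → IsWeaklyRegular R (x ^ s :: y.map (· ^ t))) := by
  have hreg' : IsWeaklyRegular R [x] := by
    rw [isWeaklyRegular_singleton_iff]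
    exact Module.Flat.isSMulRegular_of_nonZeroDivisors hreg
  obtain ⟨t, h1, h2, h3⟩ := exists_ext_reg hG [x] (by simpa using hx) hreg' d (by simp; omega)
  have h2' : ∀ a ∈ t, a ∈ maximalIdeal R := fun a ha => h2 a (by simp [ha])
  have h4 := ofList_map_pow_le t h2' (n + 1)
  refine ⟨t.map (· ^ (n+1)), by simp [h1], fun a ha => Ideal.pow_le_self (by simp) (h4 a ha),
    fun a ha => Ideal.pow_le_pow_right (Nat.le_succ n) (h4 a ha), fun s u hs hu => ?_⟩
  have h5 := wr_pow ((n+1) * u) (by positivity) t [x] h2 h3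
  have h6 := wr_pow s hs [x] (t.map (· ^ ((n+1) * u))) (by
    intro a ha
    simp only [List.mem_append, List.mem_singleton, List.mem_map] at ha
    rcases ha with ⟨b, hb, rfl⟩ | rfl
    · exact Ideal.pow_mem_of_mem _ (h2' b hb) _ (by positivity)
    · exact hx) (isWeaklyRegular_of_perm_of_subset_maximalIdeal h5 List.perm_append_comm (by
    intro a ha
    simp only [List.mem_append, List.mem_singleton, List.mem_map] at ha
    rcases ha with rfl | ⟨b, hb, rfl⟩
    · exact hx
    · exact Ideal.pow_mem_of_mem _ (h2' b hb) _ (by positivity)))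
  have h7 := isWeaklyRegular_of_perm_of_subset_maximalIdeal h6 List.perm_append_comm (by
    intro a ha
    simp only [List.mem_append, List.mem_singleton, List.mem_map, List.map_cons, List.map_nil] at ha
    rcases ha with ⟨b, hb, rfl⟩ | rfl
    · exact Ideal.pow_mem_of_mem _ (h2' b hb) _ (by positivity)
    · exact Ideal.pow_mem_of_mem _ hx _ hs)
  simpa [List.map_map, Function.comp_def, pow_mul] using h7

/-- `x` is regular modulo `y`. -/
theorem x_regular {R : Type u} [CommRing R] [IsNoetherianRing R] [IsLocalRing R]
    (x : R) (y : List R) (hx : x ∈ maximalIdeal R) (hy : ∀ a ∈ y, a ∈ maximalIdeal R)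
    (h : IsWeaklyRegular R (x :: y)) (a : R) (n : ℕ) (ha : x ^ n * a ∈ Ideal.ofList y) :
    a ∈ Ideal.ofList y := by
  have h1 : IsWeaklyRegular R (y ++ [x]) :=
    isWeaklyRegular_of_perm_of_subset_maximalIdeal h (List.perm_append_singleton x y).symm
      (by simpa using ⟨hx, hy⟩)
  have h2 := (((wr_snoc _ _).1 h1).2).pow n
  have h3 : Ideal.Quotient.mk (Ideal.ofList y) a = 0 := by
    apply h2
    change Ideal.Quotient.mk (Ideal.ofList y) (x ^ n * a) = x ^ n • 0
    rw [smul_zero]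
    exact Ideal.Quotient.eq_zero_iff_mem.2 ha
  exact Ideal.Quotient.eq_zero_iff_mem.1 h3

end Reg

section LC
open RingTheory.Sequence IsLocalRing Module CategoryTheory Abelian
open scoped Pointwise

theorem mk_mem_max {R : Type u} [CommRing R] [IsLocalRing R] (x : R) (hx : x ∈ maximalIdeal R)
    [IsLocalRing (R ⧸ Ideal.span {x})] (r : R) :
    Ideal.Quotient.mk (Ideal.span {x}) r ∈ maximalIdeal (R ⧸ Ideal.span {x}) ↔
      r ∈ maximalIdeal R := by
  constructor
  · intro h hu
    exact h (hu.map _)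
  · intro h hu
    obtain ⟨s, hs⟩ := hu.exists_right_inv
    obtain ⟨s, rfl⟩ := Ideal.Quotient.mk_surjective s
    rw [← map_mul, ← map_one (Ideal.Quotient.mk (Ideal.span {x})), Ideal.Quotient.eq] at hs
    have h1 : r * s - 1 ∈ maximalIdeal R := (Ideal.span_singleton_le_iff_mem _).2 hx hs
    have h2 : r * s ∈ maximalIdeal R := Ideal.mul_mem_right _ _ h
    have h3 : (1 : R) ∈ maximalIdeal R := by
      have := Ideal.sub_mem _ h2 h1
      simpa using this
    exact h3 isUnit_one

theorem mk_mem_ofList {R : Type u} [CommRing R] (x : R) (y : List R) (u : R) :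
    Ideal.Quotient.mk (Ideal.span {x}) u ∈ Ideal.ofList (y.map (Ideal.Quotient.mk (Ideal.span {x})))
      ↔ u ∈ Ideal.ofList (x :: y) := by
  rw [← Ideal.map_ofList, ← Ideal.mem_comap,
    Ideal.comap_map_of_surjective _ Ideal.Quotient.mk_surjective, ← RingHom.ker_eq_comap_bot,
    Ideal.mk_ker, Ideal.ofList_cons, sup_comm]

theorem gorLike_quot {R : Type u} [CommRing R] [IsNoetherianRing R] [IsLocalRing R] {d : ℕ}
    (hG : GorLike R (d + 1)) (x : R) (hx : x ∈ maximalIdeal R) (hreg : x ∈ nonZeroDivisors R)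
    [IsLocalRing (R ⧸ Ideal.span {x})] : GorLike (R ⧸ Ideal.span {x}) d := by
  obtain ⟨y, hl, hy, -, hw⟩ := exists_deep_x hG x hx hreg 1
  have hw1 : IsWeaklyRegular R (x :: y) := by simpa using hw 1 1 (by simp) (by simp)
  have hlen : (y.map (Ideal.Quotient.mk (Ideal.span {x}))).length = d := by simp [hl]
  rw [← hlen]
  apply gorLike_of
  · intro a ha
    obtain ⟨b, hb, rfl⟩ := List.mem_map.1 ha
    exact (mk_mem_max x hx b).2 (hy b hb)
  · have h1 := ((isWeaklyRegular_cons_iff R x y).1 hw1).2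
    have e : x • (⊤ : Submodule R R) = Ideal.span {x} := by
      simp [← Submodule.ideal_span_singleton_smul]
    have h2 : IsWeaklyRegular (R := R) (R ⧸ Ideal.span {x}) y :=
      ((Submodule.quotEquivOfEq _ _ e).isWeaklyRegular_congr y).1 h1
    exact (isWeaklyRegular_map_algebraMap_iff (R ⧸ Ideal.span {x}) (R ⧸ Ideal.span {x}) y).2 h2
  · intro a b ha hka hkb
    obtain ⟨a, rfl⟩ := Ideal.Quotient.mk_surjective a
    obtain ⟨b, rfl⟩ := Ideal.Quotient.mk_surjective b
    have hs := hG.1 (x :: y) (by simpa using ⟨hx, hy⟩) hw1 (by simp [hl])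
    obtain ⟨r, hr⟩ := hs a b (fun h => ha ((mk_mem_ofList x y a).2 h))
      (fun t ht => (mk_mem_ofList x y _).1 (by
        rw [map_mul]; exact hka _ ((mk_mem_max x hx t).2 ht)))
      (fun t ht => (mk_mem_ofList x y _).1 (by
        rw [map_mul]; exact hkb _ ((mk_mem_max x hx t).2 ht)))
    refine ⟨Ideal.Quotient.mk _ r, ?_⟩
    rw [← map_mul, ← map_sub, mk_mem_ofList]
    exact hr

theorem killed_pow {A : Type u} [CommRing A] (J : Ideal A) (r : A) (hr : r ∈ J)
    (z : A ⧸ J) : r • z = 0 := by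
  obtain ⟨z, rfl⟩ := Ideal.Quotient.mk_surjective z
  exact Ideal.Quotient.eq_zero_iff_mem.2 (Ideal.mul_mem_right _ _ hr)

theorem exists_hom_lc {A : Type u} [CommRing A] [IsNoetherianRing A] [IsLocalRing A] {d : ℕ}
    (hd : ringKrullDim A = d) (hG : GorLike A d)
    {N : Type u} [AddCommGroup N] [Module A N] [Module.Finite A N] (n : ℕ)
    (hN : ∀ r ∈ maximalIdeal A ^ n, ∀ z : N, r • z = 0) (z : N) (hz : z ≠ 0) :
    ∃ g : N →ₗ[A] ((localCohomology (maximalIdeal A) d).obj (ModuleCat.of A A)), g z ≠ 0 := by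
  have hinj := lc_inj (maximalIdeal A) d (ModuleCat.of A A) (by
    intro a b hab
    obtain ⟨ss, hl, hm, hmb, hw⟩ := exists_deep hG b
    subst hl
    obtain ⟨-, η, hη⟩ := ext_reg_ring ss hw
    have ha := hη (ModuleCat.of A (A ⧸ maximalIdeal A ^ a))
      (fun r hr z => killed_pow _ r (Ideal.pow_le_pow_right hab (hmb r hr)) z)
    have hb := hη (ModuleCat.of A (A ⧸ maximalIdeal A ^ b))
      (fun r hr z => killed_pow _ r (hmb r hr) z)
    intro e₁ e₂ he
    obtain ⟨f₁, rfl⟩ := ha.2 e₁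
    obtain ⟨f₂, rfl⟩ := ha.2 e₂
    let π : (A ⧸ maximalIdeal A ^ b) →ₗ[A] (A ⧸ maximalIdeal A ^ a) :=
      Submodule.mapQ (maximalIdeal A ^ b) (maximalIdeal A ^ a) LinearMap.id
        (Ideal.pow_le_pow_right hab)
    have key : ∀ f : (A ⧸ maximalIdeal A ^ a) →ₗ[A] A ⧸ Ideal.ofList ss,
        (Ext.mk₀ (ModuleCat.ofHom π)).comp
          (extCmp (N := ModuleCat.of A (A ⧸ maximalIdeal A ^ a)) η f) (zero_add _) =
        extCmp (N := ModuleCat.of A (A ⧸ maximalIdeal A ^ b)) η (f.comp π) := by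
      intro f
      change (Ext.mk₀ (ModuleCat.ofHom π)).comp ((Ext.mk₀ (ModuleCat.ofHom f)).comp η (zero_add _)) (zero_add _) =
        (Ext.mk₀ (ModuleCat.ofHom (f.comp π))).comp η (zero_add _)
      rw [ModuleCat.ofHom_comp, ← Ext.mk₀_comp_mk₀]
      exact (Ext.comp_assoc _ _ _ _ _ (by simp)).symm
    have he2 : f₁.comp π = f₂.comp π := by
      apply hb.1
      exact (key f₁).symm.trans (Eq.trans he (key f₂))
    have hπ : Function.Surjective π := by
      intro w
      obtain ⟨w, rfl⟩ := Submodule.Quotient.mk_surjective _ w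
      exact ⟨Submodule.Quotient.mk w, rfl⟩
    congr 1
    exact (LinearMap.cancel_right hπ).1 he2) n
  obtain ⟨F, hF⟩ := hinj
  obtain ⟨ss, hl, hm, hmn, hw⟩ := exists_deep hG n
  obtain ⟨-, η, hη⟩ := ext_reg_ring ss hw
  obtain ⟨f, hf⟩ := reg_dual hd hG ss hm hw hl
    (fun r hr z => hN r (Ideal.span_le.2 hmn hr) z) z hz
  subst hl
  have ha := hη (ModuleCat.of A (A ⧸ maximalIdeal A ^ n))
      (fun r hr z => killed_pow _ r (hmn r hr) z)
  let T : N →ₗ[A] ((A ⧸ maximalIdeal A ^ n) →ₗ[A] A ⧸ Ideal.ofList ss) :=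
    { toFun := fun w => Submodule.liftQ (maximalIdeal A ^ n) (LinearMap.toSpanSingleton A _ (f w))
        (fun t ht => by
          rw [LinearMap.mem_ker, LinearMap.toSpanSingleton_apply, ← map_smul, hN t ht, map_zero])
      map_add' := fun a b => by
        apply Submodule.linearMap_qext
        ext
        change (1 : A) • f (a + b) = (1 : A) • f a + (1 : A) • f b
        simp
      map_smul' := fun r a => by
        apply Submodule.linearMap_qext
        ext
        change (1 : A) • f (r • a) = r • (1 : A) • f a
        simp }
  have hT : T z (Submodule.Quotient.mk 1) = f z :=
    (Submodule.liftQ_apply _ _ _).trans (one_smul A _)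
  refine ⟨F ∘ₗ (extCmp (N := ModuleCat.of A (A ⧸ maximalIdeal A ^ n)) η) ∘ₗ T, fun h0 => ?_⟩
  have h1 : extCmp (N := ModuleCat.of A (A ⧸ maximalIdeal A ^ n)) η (T z) = 0 :=
    hF (h0.trans (map_zero F).symm)
  have h2 : T z = 0 := ha.1 (h1.trans (map_zero _).symm)
  rw [h2] at hT
  exact hf hT.symm
end LC

section Fin1

theorem fstar_smul (p e : ℕ) {A : Type u} [CommRing A] [Fact p.Prime] [CharP A p] (r : A)
    (s : Fstar p e A) : r • s = (show Fstar p e A from r ^ p ^ e * (show A from s)) := rfl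

theorem tens_one {p e : ℕ} {R : Type u} [CommRing R] [Fact p.Prime] [CharP R p] (I : Ideal R)
    (r a : R) (h : (Ideal.Quotient.mk I r) ⊗ₜ[R] (show Fstar p e R from a) = 0) :
    r ^ p ^ e * a ∈ I.map (iterateFrobenius R p e) := by
  let J := I.map (iterateFrobenius R p e)
  let φ : R ⧸ I →+* R ⧸ J := Ideal.quotientMap J (iterateFrobenius R p e) Ideal.le_comap_map
  let ψ : Fstar p e R →+ R ⧸ J := ((Ideal.Quotient.mk J : R →+* R ⧸ J) : R →+ R ⧸ J)
  let f : R ⧸ I →+ Fstar p e R →+ R ⧸ J :=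
    ((AddMonoidHom.compl₂ (AddMonoidHom.mul (R := R ⧸ J)) ψ).comp (φ : R ⧸ I →+ R ⧸ J))
  have hf : ∀ m n, f m n = φ m * ψ n := fun _ _ => rfl
  have hbal : ∀ (r : R) (m : R ⧸ I) (n : Fstar p e R), f (r • m) n = f m (r • n) := by
    intro r m n
    rw [hf, hf]
    obtain ⟨m, rfl⟩ := Ideal.Quotient.mk_surjective m
    change Ideal.Quotient.mk J (((r * m : R)) ^ p ^ e) * Ideal.Quotient.mk J (show R from n) =
      Ideal.Quotient.mk J (m ^ p ^ e) * Ideal.Quotient.mk J (r ^ p ^ e * (show R from n))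
    rw [← map_mul, ← map_mul, mul_pow]
    congr 1
    ring
  have := congrArg (TensorProduct.liftAddHom f hbal) h
  rw [TensorProduct.liftAddHom_tmul, map_zero] at this
  have h2 : Ideal.Quotient.mk J (r ^ p ^ e * a) = 0 := by
    rw [map_mul]; exact this
  exact Ideal.Quotient.eq_zero_iff_mem.1 h2

theorem tens_two {p e : ℕ} {A : Type u} [CommRing A] [Fact p.Prime] [CharP A p] (I : Ideal A)
    (c : A) (h : c ^ p ^ e ∈ I.map (iterateFrobenius A p e)) :
    (Ideal.Quotient.mk I c) ⊗ₜ[A] (1 : Fstar p e A) = 0 := by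
  have key : ∀ s ∈ I.map (iterateFrobenius A p e),
      (Ideal.Quotient.mk I 1) ⊗ₜ[A] (show Fstar p e A from s) = 0 := by
    intro s hs
    have hh : ∀ t : A,
      (Ideal.Quotient.mk I 1) ⊗ₜ[A] (show Fstar p e A from (t * s : A)) = 0 := by
     refine Submodule.span_induction (p := fun (s : A) _ => ∀ t : A,
      (Ideal.Quotient.mk I 1) ⊗ₜ[A] (show Fstar p e A from (t * s : A)) = 0) ?_ ?_ ?_ ?_ hs
     · rintro _ ⟨b, hb, rfl⟩ t
       have : (show Fstar p e A from t * iterateFrobenius A p e b) =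
           b • (show Fstar p e A from t) := mul_comm _ _
       rw [this, ← TensorProduct.smul_tmul, killed_pow I b hb, TensorProduct.zero_tmul]
     · intro t
       have : (show Fstar p e A from (t * 0 : A)) = 0 := mul_zero t
       rw [this, TensorProduct.tmul_zero]
     · intro a b _ _ ha hb t
       have : (show Fstar p e A from t * (a + b)) =
         (show Fstar p e A from t * a) + (show Fstar p e A from t * b) := mul_add (R := A) _ _ _
       rw [this, TensorProduct.tmul_add, ha, hb, add_zero]
     · intro a b _ hb t
       have : (show Fstar p e A from t * (a • b)) =
         (show Fstar p e A from (t * a) * b) := (mul_assoc (G := A) _ _ _).symm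
       rw [this, hb]
    have := hh 1
    rwa [one_mul] at this
  have h1 : Ideal.Quotient.mk I c = c • Ideal.Quotient.mk I 1 := by
    change _ = Ideal.Quotient.mk I (c * 1)
    rw [mul_one]
  have h2 : c • (1 : Fstar p e A) = (show Fstar p e A from c ^ p ^ e) := mul_one (M := A) _
  rw [h1, TensorProduct.smul_tmul, h2, key _ h]

theorem step_one {p e : ℕ} {R : Type u} [CommRing R] [Fact p.Prime] [CharP R p] (x : R)
    [CharP (R ⧸ Ideal.span {x}) p] (h : PureAt p e R (x ^ (p ^ e - 1))) :
    PureAt p e (R ⧸ Ideal.span {x}) 1 := by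
  intro P _ _
  let _ : Module R P := Module.compHom P (Ideal.Quotient.mk (Ideal.span {x}))
  have hsm : ∀ (r : R) (m : P), r • m = Ideal.Quotient.mk (Ideal.span {x}) r • m := fun _ _ => rfl
  have hq : 0 < p ^ e := pow_pos (Fact.out : p.Prime).pos _
  let T : P → R → P ⊗[R] Fstar p e R :=
    fun m s => m ⊗ₜ[R] (show Fstar p e R from x ^ (p ^ e - 1) * s)
  have hTadd : ∀ m s t, T m (s + t) = T m s + T m t := by
    intro m s t
    have : (show Fstar p e R from x ^ (p ^ e - 1) * (s + t)) =
        (show Fstar p e R from x ^ (p ^ e - 1) * s) + (show Fstar p e R from x ^ (p ^ e - 1) * t) :=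
      mul_add (R := R) _ _ _
    change m ⊗ₜ[R] (show Fstar p e R from x ^ (p ^ e - 1) * (s + t)) = _
    rw [this, TensorProduct.tmul_add]
  have hTx : ∀ m t, T m (x * t) = 0 := by
    intro m t
    have : (show Fstar p e R from x ^ (p ^ e - 1) * (x * t)) = x • (show Fstar p e R from t) := by
      change x ^ (p ^ e - 1) * (x * t) = x ^ p ^ e * t
      rw [← mul_assoc, ← pow_succ, Nat.sub_add_cancel hq]
    change m ⊗ₜ[R] (show Fstar p e R from x ^ (p ^ e - 1) * (x * t)) = _
    rw [this, ← TensorProduct.smul_tmul, hsm,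
      Ideal.Quotient.eq_zero_iff_mem.2 (Ideal.mem_span_singleton_self x), zero_smul,
      TensorProduct.zero_tmul]
  have hT : ∀ m s t, Ideal.Quotient.mk (Ideal.span {x}) s = Ideal.Quotient.mk (Ideal.span {x}) t →
      T m s = T m t := by
    intro m s t hst
    rw [Ideal.Quotient.eq, Ideal.mem_span_singleton] at hst
    obtain ⟨w, hw⟩ := hst
    have : s = t + x * w := by rw [← hw]; ring
    rw [this, hTadd, hTx, add_zero]
  have hout : ∀ a : R ⧸ Ideal.span {x}, Ideal.Quotient.mk (Ideal.span {x}) (Quotient.out a) = a :=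
    fun a => Ideal.Quotient.mk_out a
  let f : P →+ Fstar p e (R ⧸ Ideal.span {x}) →+ P ⊗[R] Fstar p e R :=
    AddMonoidHom.mk' (fun m => AddMonoidHom.mk'
      (fun a => T m (Quotient.out (show R ⧸ Ideal.span {x} from a)))
      (by
        intro a b
        rw [← hTadd]
        apply hT
        rw [map_add, hout, hout, hout]
        rfl))
      (by
        intro m m'
        ext a
        exact TensorProduct.add_tmul _ _ _)
  have hbal : ∀ (r : R ⧸ Ideal.span {x}) (m : P) (n : Fstar p e (R ⧸ Ideal.span {x})),
      f (r • m) n = f m (r • n) := by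
    intro r m n
    obtain ⟨r, rfl⟩ := Ideal.Quotient.mk_surjective r
    change T (r • m) (Quotient.out (show R ⧸ Ideal.span {x} from n)) = T m (Quotient.out _)
    have h1 : ∀ s, T (r • m) s = T m (r ^ p ^ e * s) := by
      intro s
      change (r • m) ⊗ₜ[R] _ = _
      rw [TensorProduct.smul_tmul]
      change m ⊗ₜ[R] (show Fstar p e R from r ^ p ^ e * (x ^ (p ^ e - 1) * s)) =
        m ⊗ₜ[R] (show Fstar p e R from x ^ (p ^ e - 1) * (r ^ p ^ e * s))
      congr 1
      exact mul_left_comm (G := R) _ _ _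
    rw [h1]
    apply hT
    rw [map_mul, hout, hout, map_pow]
    rfl
  intro m m' hmm
  have h2 := congrArg (TensorProduct.liftAddHom f hbal) hmm
  have h3 : ∀ m, f m 1 = m ⊗ₜ[R] (show Fstar p e R from x ^ (p ^ e - 1)) := by
    intro m
    change T m (Quotient.out (1 : R ⧸ Ideal.span {x})) = _
    rw [hT m _ 1 (by rw [hout, map_one])]
    change m ⊗ₜ[R] (show Fstar p e R from (x ^ (p ^ e - 1) * 1 : R)) = _
    rw [mul_one]
  apply h P
  change m ⊗ₜ[R] (show Fstar p e R from x ^ (p ^ e - 1)) =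
    m' ⊗ₜ[R] (show Fstar p e R from x ^ (p ^ e - 1))
  rw [← h3, ← h3]
  exact h2
end Fin1

section Fin2
open RingTheory.Sequence
open scoped Pointwise

theorem mem_ofList_cons {R : Type u} [CommRing R] (a u : R) (l : List R) :
    u ∈ Ideal.ofList (a :: l) ↔ ∃ c, u - a * c ∈ Ideal.ofList l := by
  rw [Ideal.ofList_cons, Submodule.mem_sup]
  constructor
  · rintro ⟨v, hv, w, hw, rfl⟩
    obtain ⟨c, rfl⟩ := Ideal.mem_span_singleton.1 hv
    exact ⟨c, by simpa using hw⟩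
  · rintro ⟨c, hc⟩
    exact ⟨a * c, Ideal.mem_span_singleton.2 ⟨c, rfl⟩, _, hc, by ring⟩

theorem frob_ofList {R : Type u} [CommRing R] (p e : ℕ) [Fact p.Prime] [CharP R p] (y : List R) :
    (Ideal.ofList y).map (iterateFrobenius R p e) = Ideal.ofList (y.map (· ^ p ^ e)) := by
  rw [Ideal.map_ofList]; rfl

theorem core_c {R : Type u} [CommRing R] [IsNoetherianRing R] [IsLocalRing R] (p e : ℕ)
    [Fact p.Prime] [CharP R p] (x : R) (y : List R) (hx : x ∈ maximalIdeal R)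
    (hy : ∀ a ∈ y, a ∈ maximalIdeal R) (hw : IsWeaklyRegular R (x :: y))
    (hwq : IsWeaklyRegular R (x :: y.map (· ^ p ^ e))) (m : ℕ)
    (K : ∀ c, c ^ p ^ e ∈ Ideal.ofList (x :: y.map (· ^ p ^ e)) → c ∈ Ideal.ofList (x :: y))
    (r : R) (hxr : x * r ∈ Ideal.ofList (x ^ (m + 1) :: y))
    (hQ : r ^ p ^ e * x ^ (p ^ e - 1) ∈
      Ideal.ofList ((x ^ (m + 1)) ^ p ^ e :: y.map (· ^ p ^ e))) :
    r ∈ Ideal.ofList (x ^ (m + 1) :: y) := by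
  obtain ⟨k, hk⟩ : ∃ k, p ^ e = k + 1 :=
    ⟨p ^ e - 1, (Nat.sub_add_cancel (pow_pos (Fact.out : p.Prime).pos _)).symm⟩
  obtain ⟨c, hc⟩ := (mem_ofList_cons _ _ _).1 hxr
  have h1 : r - x ^ m * c ∈ Ideal.ofList y := by
    apply x_regular x y hx hy hw _ 1
    convert hc using 1
    ring
  have h2 : r ^ p ^ e - (x ^ m * c) ^ p ^ e ∈ Ideal.ofList (y.map (· ^ p ^ e)) := by
    rw [← sub_pow_char_pow, ← frob_ofList]
    exact Ideal.mem_map_of_mem (iterateFrobenius R p e) h1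
  obtain ⟨v, hv⟩ := (mem_ofList_cons _ _ _).1 hQ
  have h3 : c ^ p ^ e - x * v ∈ Ideal.ofList (y.map (· ^ p ^ e)) := by
    apply x_regular x _ hx _ hwq _ (m * p ^ e + (p ^ e - 1))
    · have h4 := Ideal.sub_mem _ hv (Ideal.mul_mem_right (x ^ (p ^ e - 1)) _ h2)
      convert h4 using 1
      rw [hk, Nat.add_sub_cancel]
      ring
    · intro a ha
      obtain ⟨b, hb, rfl⟩ := List.mem_map.1 ha
      exact Ideal.pow_mem_of_mem _ (hy b hb) _ (pow_pos (Fact.out : p.Prime).pos _)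
  obtain ⟨u, hu⟩ := (mem_ofList_cons _ _ _).1 (K c ((mem_ofList_cons _ _ _).2 ⟨v, h3⟩))
  refine (mem_ofList_cons _ _ _).2 ⟨u, ?_⟩
  have := Ideal.add_mem _ h1 (Ideal.mul_mem_left _ (x ^ m) hu)
  convert this using 1
  ring

theorem core_r {R : Type u} [CommRing R] [IsNoetherianRing R] [IsLocalRing R] (p e : ℕ)
    [Fact p.Prime] [CharP R p] (x : R) (y : List R) (hx : x ∈ maximalIdeal R)
    (hy : ∀ a ∈ y, a ∈ maximalIdeal R) (hw : IsWeaklyRegular R (x :: y))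
    (hwq : IsWeaklyRegular R (x :: y.map (· ^ p ^ e))) (m : ℕ)
    (K : ∀ c, c ^ p ^ e ∈ Ideal.ofList (x :: y.map (· ^ p ^ e)) → c ∈ Ideal.ofList (x :: y))
    (r : R)
    (hQ : r ^ p ^ e * x ^ (p ^ e - 1) ∈
      Ideal.ofList ((x ^ (m + 1)) ^ p ^ e :: y.map (· ^ p ^ e))) :
    r ∈ Ideal.ofList (x ^ (m + 1) :: y) := by
  have main : ∀ (j : ℕ) (r : R), r ^ p ^ e * x ^ (p ^ e - 1) ∈
      Ideal.ofList ((x ^ (m + 1)) ^ p ^ e :: y.map (· ^ p ^ e)) →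
      x ^ j * r ∈ Ideal.ofList (x ^ (m + 1) :: y) → r ∈ Ideal.ofList (x ^ (m + 1) :: y) := by
    intro j
    induction j with
    | zero => intro r _ h; simpa using h
    | succ j ih =>
      intro r hQ h
      refine core_c p e x y hx hy hw hwq m K r (ih (x * r) ?_ ?_) hQ
      · have := Ideal.mul_mem_left _ (x ^ p ^ e) hQ
        convert this using 1
        ring
      · convert h using 1
        ring
  refine main (m + 1) r hQ ?_
  exact Ideal.mul_mem_right _ _ ((mem_ofList_cons _ _ _).2 ⟨1, by simp⟩)

theorem K_of_inj {R : Type u} [CommRing R] [IsNoetherianRing R] [IsLocalRing R] (p e : ℕ)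
    [Fact p.Prime] [CharP R p] (x : R) (y : List R) (hx : x ∈ maximalIdeal R)
    [IsLocalRing (R ⧸ Ideal.span {x})] [CharP (R ⧸ Ideal.span {x}) p]
    (hy : ∀ a ∈ y, a ∈ maximalIdeal R) (hw : IsWeaklyRegular R (x :: y))
    {d : ℕ} (hl : y.length = d) (hd : ringKrullDim (R ⧸ Ideal.span {x}) = d)
    (hG : GorLike (R ⧸ Ideal.span {x}) d)
    (hinj : Function.Injective
          (fun m : ↥((localCohomology (maximalIdeal (R ⧸ Ideal.span {x})) d).obj
              (ModuleCat.of (R ⧸ Ideal.span {x}) (R ⧸ Ideal.span {x}))) =>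
            (m ⊗ₜ[R ⧸ Ideal.span {x}] (1 : Fstar p e (R ⧸ Ideal.span {x})) :
              TensorProduct (R ⧸ Ideal.span {x})
                ↥((localCohomology (maximalIdeal (R ⧸ Ideal.span {x})) d).obj
                  (ModuleCat.of (R ⧸ Ideal.span {x}) (R ⧸ Ideal.span {x})))
                (Fstar p e (R ⧸ Ideal.span {x}))))) (c : R)
    (hc : c ^ p ^ e ∈ Ideal.ofList (x :: y.map (· ^ p ^ e))) : c ∈ Ideal.ofList (x :: y) := by
  let yb := y.map (Ideal.Quotient.mk (Ideal.span {x}))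
  have hyb : ∀ a ∈ yb, a ∈ maximalIdeal (R ⧸ Ideal.span {x}) := by
    intro a ha
    obtain ⟨b, hb, rfl⟩ := List.mem_map.1 ha
    exact (mk_mem_max x hx b).2 (hy b hb)
  have hwb : IsWeaklyRegular (R ⧸ Ideal.span {x}) yb := by
    have h1 := ((isWeaklyRegular_cons_iff R x y).1 hw).2
    have e : x • (⊤ : Submodule R R) = Ideal.span {x} := by
      simp [← Submodule.ideal_span_singleton_smul]
    have h2 : IsWeaklyRegular (R := R) (R ⧸ Ideal.span {x}) y :=
      ((Submodule.quotEquivOfEq _ _ e).isWeaklyRegular_congr y).1 h1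
    exact (isWeaklyRegular_map_algebraMap_iff (R ⧸ Ideal.span {x}) (R ⧸ Ideal.span {x}) y).2 h2
  have hlb : yb.length = d := by simp [yb, hl]
  rw [← mk_mem_ofList]
  by_contra hne
  have hfl := fl_of_reg hd yb hyb hwb hlb
  have hart : IsArtinianRing ((R ⧸ Ideal.span {x}) ⧸ Ideal.ofList yb) := by
    have := (isFiniteLength_iff_isNoetherian_isArtinian.1 hfl).2
    exact isArtinian_of_tower (R ⧸ Ideal.span {x}) this
  obtain ⟨N, hN⟩ := IsLocalRing.exists_maximalIdeal_pow_le_of_isArtinianRing_quotient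
    (Ideal.ofList yb)
  have ht : (Ideal.Quotient.mk (Ideal.ofList yb) (Ideal.Quotient.mk (Ideal.span {x}) c))
      ⊗ₜ[R ⧸ Ideal.span {x}] (1 : Fstar p e (R ⧸ Ideal.span {x})) = 0 := by
    apply tens_two
    rw [frob_ofList, ← map_pow]
    have := (mk_mem_ofList x _ _).2 hc
    simpa [yb, List.map_map, Function.comp_def] using this
  obtain ⟨g, hg⟩ := exists_hom_lc hd hG (N := (R ⧸ Ideal.span {x}) ⧸ Ideal.ofList yb) N
    (fun r hr z => killed_pow _ r (hN hr) z)
    (Ideal.Quotient.mk (Ideal.ofList yb) (Ideal.Quotient.mk (Ideal.span {x}) c))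
    (fun h => hne (Ideal.Quotient.eq_zero_iff_mem.1 h))
  apply hg
  apply hinj
  have h5 := congrArg (g.rTensor (Fstar p e (R ⧸ Ideal.span {x}))) ht
  rw [LinearMap.rTensor_tmul, map_zero] at h5
  exact h5.trans (TensorProduct.zero_tmul _ _).symm

theorem step_three {R : Type u} [CommRing R] [IsNoetherianRing R] [IsLocalRing R] (p e : ℕ)
    [Fact p.Prime] [CharP R p] (x : R) (hx : x ∈ maximalIdeal R) (hreg : x ∈ nonZeroDivisors R)
    [IsLocalRing (R ⧸ Ideal.span {x})] [CharP (R ⧸ Ideal.span {x}) p]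
    {d : ℕ} (hdR : ringKrullDim R = ((d + 1 : ℕ) : WithBot ℕ∞))
    (hGR : GorLike R (d + 1)) (hd : ringKrullDim (R ⧸ Ideal.span {x}) = d)
    (hinj : Function.Injective
          (fun m : ↥((localCohomology (maximalIdeal (R ⧸ Ideal.span {x})) d).obj
              (ModuleCat.of (R ⧸ Ideal.span {x}) (R ⧸ Ideal.span {x}))) =>
            (m ⊗ₜ[R ⧸ Ideal.span {x}] (1 : Fstar p e (R ⧸ Ideal.span {x})) :
              TensorProduct (R ⧸ Ideal.span {x})
                ↥((localCohomology (maximalIdeal (R ⧸ Ideal.span {x})) d).obj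
                  (ModuleCat.of (R ⧸ Ideal.span {x}) (R ⧸ Ideal.span {x})))
                (Fstar p e (R ⧸ Ideal.span {x}))))) :
    PureAt p e R (x ^ (p ^ e - 1)) := by
  have hG := gorLike_quot hGR x hx hreg
  have ha : ∀ (P : Type u) [AddCommGroup P] [Module R P] (z : P),
      z ⊗ₜ[R] (show Fstar p e R from x ^ (p ^ e - 1)) = 0 → z = 0 := by
    intro P _ _ z hz
    by_contra hz0
    have hfg : (Submodule.span R {z}).FG := Submodule.fg_span_singleton z
    obtain ⟨Q, hPQ, hQ, h0⟩ := TensorProduct.eq_zero_of_fg_of_subtype_eq_zero hfg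
      (t := (⟨z, Submodule.mem_span_singleton_self z⟩ : Submodule.span R {z}) ⊗ₜ[R]
        (show Fstar p e R from x ^ (p ^ e - 1))) (by
        rw [LinearMap.rTensor_tmul]; exact hz)
    rw [LinearMap.rTensor_tmul] at h0
    set w : Q := Submodule.inclusion hPQ ⟨z, Submodule.mem_span_singleton_self z⟩ with hwdef
    have hw0 : w ≠ 0 := fun h => hz0 (congrArg Subtype.val h)
    have : Module.Finite R Q := Module.Finite.iff_fg.2 hQ
    have hkr := Ideal.iInf_pow_smul_eq_bot_of_isLocalRing (M := Q) (maximalIdeal R)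
      (Ideal.IsPrime.ne_top inferInstance)
    obtain ⟨n, hn⟩ : ∃ n : ℕ, w ∉ (maximalIdeal R ^ n • ⊤ : Submodule R Q) := by
      by_contra! hcon
      apply hw0
      have : w ∈ (⨅ i : ℕ, maximalIdeal R ^ i • ⊤ : Submodule R Q) := Submodule.mem_iInf _ |>.2 hcon
      rw [hkr] at this
      exact this
    obtain ⟨m, rfl⟩ : ∃ m, n = m + 1 := by
      refine Nat.exists_eq_succ_of_ne_zero ?_
      rintro rfl
      apply hn
      simp
    obtain ⟨y, hl, hy, hyn, hwr⟩ := exists_deep_x hGR x hx hreg (m + 1)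
    have hw1 : IsWeaklyRegular R (x :: y) := by simpa using hwr 1 1 (by simp) (by simp)
    have hwq : IsWeaklyRegular R (x :: y.map (· ^ p ^ e)) := by
      simpa using hwr 1 (p ^ e) (by simp) (pow_pos (Fact.out : p.Prime).pos _)
    have hwm : IsWeaklyRegular R (x ^ (m + 1) :: y) := by simpa using hwr (m + 1) 1 (by simp) (by simp)
    have hIn : Ideal.ofList (x ^ (m + 1) :: y) ≤ maximalIdeal R ^ (m + 1) := by
      refine Ideal.span_le.2 ?_
      intro a ha
      rcases List.mem_cons.1 ha with rfl | ha
      · exact Ideal.pow_mem_pow hx _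
      · exact hyn a ha
    let N := Q ⧸ (maximalIdeal R ^ (m + 1) • ⊤ : Submodule R Q)
    obtain ⟨f, hf⟩ := reg_dual (N := N) hdR hGR (x ^ (m + 1) :: y)
      (by
        intro a ha
        exact Ideal.pow_le_self (Nat.succ_ne_zero m) (hIn (Ideal.subset_span ha)))
      hwm (by simp [hl])
      (by
        intro r hr z
        obtain ⟨z, rfl⟩ := Submodule.Quotient.mk_surjective _ z
        rw [← Submodule.Quotient.mk_smul, Submodule.Quotient.mk_eq_zero]
        exact Submodule.smul_mem_smul (hIn hr) trivial)
      (Submodule.Quotient.mk w)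
      (by rwa [Ne, Submodule.Quotient.mk_eq_zero])
    obtain ⟨r, hr⟩ := Ideal.Quotient.mk_surjective (f (Submodule.Quotient.mk w))
    have h6 := congrArg ((f ∘ₗ Submodule.mkQ _).rTensor (Fstar p e R)) h0
    rw [LinearMap.rTensor_tmul, map_zero] at h6
    have h7 : (Ideal.Quotient.mk (Ideal.ofList (x ^ (m + 1) :: y)) r) ⊗ₜ[R]
        (show Fstar p e R from x ^ (p ^ e - 1)) = 0 := by
      rw [hr]; exact h6
    have h8 := tens_one _ _ _ h7
    rw [frob_ofList] at h8
    have h9 := core_r p e x y hx hy hw1 hwq m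
      (K_of_inj p e x y hx hy hw1 hl hd hG hinj) r h8
    exact hf (hr.symm.trans (Ideal.Quotient.eq_zero_iff_mem.2 h9))
  intro P _ _ z z' hzz
  rw [← sub_eq_zero]
  apply ha
  rw [TensorProduct.sub_tmul]
  exact sub_eq_zero.2 hzz
end Fin2

/-- Let `(R, m, k)` be a `d`-dimensional Gorenstein Noetherian local ring of
prime characteristic `p` and `x ∈ m` a nonzerodivisor.  Then for each `e ≥ 1` the map
`R → F^e_* R`, `1 ↦ F^e_* x^{p^e − 1}`, is pure if and only if the Frobenius of `R/xR`
becomes injective after tensoring with `H^{d−1}_m(R/xR)`; equivalently (taking all `e`),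
the pair `(R, div x)` is `F`-pure if and only if `R/xR` is `F`-pure. -/
theorem stmt15 {R : Type u} [CommRing R] [IsNoetherianRing R] [IsLocalRing R]
    (p : ℕ) [Fact p.Prime] [CharP R p]
    (hGor : IsGorensteinLocalRing R)
    (d : ℕ) (hd : ringKrullDim R = d)
    (x : R) (hx : x ∈ maximalIdeal R) (hreg : x ∈ nonZeroDivisors R)
    [IsLocalRing (R ⧸ Ideal.span {x})] [CharP (R ⧸ Ideal.span {x}) p] :
    (∀ e : ℕ, 0 < e →
      (PureAt p e R (x ^ (p ^ e - 1)) ↔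
        Function.Injective
          (fun m : ↥((localCohomology (maximalIdeal (R ⧸ Ideal.span {x})) (d - 1)).obj
              (ModuleCat.of (R ⧸ Ideal.span {x}) (R ⧸ Ideal.span {x}))) =>
            (m ⊗ₜ[R ⧸ Ideal.span {x}] (1 : Fstar p e (R ⧸ Ideal.span {x})) :
              TensorProduct (R ⧸ Ideal.span {x})
                ↥((localCohomology (maximalIdeal (R ⧸ Ideal.span {x})) (d - 1)).obj
                  (ModuleCat.of (R ⧸ Ideal.span {x}) (R ⧸ Ideal.span {x})))
                (Fstar p e (R ⧸ Ideal.span {x})))))) ∧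
    ((∀ e : ℕ, 0 < e → PureAt p e R (x ^ (p ^ e - 1))) ↔
      IsFPureRing p (R ⧸ Ideal.span {x})) := by
  have hdim := ringKrullDim_quotient_span_singleton_succ_eq_ringKrullDim_of_mem_nonZeroDivisors
    hreg hx
  rw [hd] at hdim
  have hnb : ringKrullDim (R ⧸ Ideal.span {x}) ≠ ⊥ := ringKrullDim_ne_bot
  obtain ⟨a, ha⟩ := WithBot.ne_bot_iff_exists.1 hnb
  rw [← ha] at hdim
  have hdim2 : a + 1 = (d : ℕ∞) := by exact_mod_cast hdim
  have hat : a ≠ ⊤ := by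
    rintro rfl
    simp at hdim2
  obtain ⟨k, rfl⟩ := ENat.ne_top_iff_exists.1 hat
  have hdk : k + 1 = d := by exact_mod_cast hdim2
  subst hdk
  have hA : ringKrullDim (R ⧸ Ideal.span {x}) = k := ha.symm
  have hG := gorLike hGor (k + 1) hd
  have h3 := fun e => step_three p e x hx hreg hd hG hA
  refine ⟨fun e _ => ⟨fun h => step_one x h _, h3 e⟩, fun h e he => step_one x (h e he), fun h e he => ?_⟩
  exact h3 e (h e he _)
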